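/- Let n ≥ 1 and let A = (A_{ij}) be an n×n real matrix whose associated quadratic form is positive definite, i.e. Σ_{i,j} A_{ij} v_i v_j > 0 for every nonzero v ∈ ℝⁿ. In the polynomial ring ℂ[x_1, …, x_n, t], set g_i := Σ_{j=1}^n A_{ij} x_i x_j − 2 t x_i for 1 ≤ i ≤ n. Then the sequence g_1, …, g_n, t of length n+1 is a regular sequence in ℂ[x_1, …, x_n, t]. -/

import Mathlib

open MvPolynomial

section

open RingTheory.Sequence
open scoped Pointwise

/-- Weakly regular sequences on the outer terms of a short exact sequence of modules are weakly
regular on the middle term. -/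
theorem isWeaklyRegular_of_exact {R : Type*} [CommRing R] (rs : List R)
    {M M₂ M₃ : Type*} [AddCommGroup M] [AddCommGroup M₂] [AddCommGroup M₃]
    [Module R M] [Module R M₂] [Module R M₃] {f : M →ₗ[R] M₂} {g : M₂ →ₗ[R] M₃}
    (hf : Function.Injective f) (hfg : Function.Exact f g) (hg : Function.Surjective g)
    (h₁ : IsWeaklyRegular M rs) (h₃ : IsWeaklyRegular M₃ rs) : IsWeaklyRegular M₂ rs := by
  induction rs generalizing M M₂ M₃ with
  | nil => exact .nil R M₂
  | cons r rs ih =>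
    rw [isWeaklyRegular_cons_iff] at h₁ h₃ ⊢
    refine ⟨isSMulRegular_of_range_eq_ker hf hfg.linearMap_ker_eq.symm h₁.1 h₃.1,
      ih (f := QuotSMulTop.map r f) (g := QuotSMulTop.map r g) ?_
        (QuotSMulTop.map_exact r hfg hg) (QuotSMulTop.map_surjective r hg) h₁.2 h₃.2⟩
    have h0 : Function.Exact (0 : PUnit →ₗ[R] M) f := by
      rw [LinearMap.exact_zero_iff_injective]; exact hf
    have := QuotSMulTop.map_first_exact_on_four_term_exact_of_isSMulRegular_last h0 hfg h₃.1
    rw [map_zero, LinearMap.exact_zero_iff_injective] at this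
    exact this

/-- If `a, rs` and `b, rs` are weakly regular sequences, then so is `a * b, rs`. -/
theorem isWeaklyRegular_mul_cons {R M : Type*} [CommRing R] [AddCommGroup M] [Module R M]
    {a b : R} {rs : List R} (ha : IsWeaklyRegular M (a :: rs))
    (hb : IsWeaklyRegular M (b :: rs)) : IsWeaklyRegular M (a * b :: rs) := by
  rw [isWeaklyRegular_cons_iff] at ha hb ⊢
  refine ⟨ha.1.mul hb.1, ?_⟩
  let f : QuotSMulTop b M →ₗ[R] QuotSMulTop (a * b) M :=
    Submodule.mapQ _ _ (LinearMap.lsmul R M a) (by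
      intro x hx
      obtain ⟨y, -, rfl⟩ := Submodule.mem_smul_pointwise_iff_exists _ _ _ |>.1 hx
      exact Submodule.mem_smul_pointwise_iff_exists _ _ _ |>.2
        ⟨y, trivial, by simp [mul_smul, smul_comm a b y]⟩)
  let g : QuotSMulTop (a * b) M →ₗ[R] QuotSMulTop a M :=
    Submodule.mapQ _ _ LinearMap.id (by
      intro x hx
      obtain ⟨y, -, rfl⟩ := Submodule.mem_smul_pointwise_iff_exists _ _ _ |>.1 hx
      exact Submodule.mem_smul_pointwise_iff_exists _ _ _ |>.2
        ⟨b • y, trivial, by simp [mul_smul]⟩)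
  refine isWeaklyRegular_of_exact rs (f := f) (g := g) ?_ ?_ ?_ hb.2 ha.2
  · rw [injective_iff_map_eq_zero]
    intro x hx
    induction x using Submodule.Quotient.induction_on with | _ x
    rw [Submodule.mapQ_apply, Submodule.Quotient.mk_eq_zero] at hx
    obtain ⟨y, -, hy⟩ := Submodule.mem_smul_pointwise_iff_exists _ _ _ |>.1 hx
    rw [Submodule.Quotient.mk_eq_zero]
    refine Submodule.mem_smul_pointwise_iff_exists _ _ _ |>.2 ⟨y, trivial, ha.1 ?_⟩
    simpa [mul_smul] using hy
  · intro x
    induction x using Submodule.Quotient.induction_on with | _ x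
    rw [Submodule.mapQ_apply, Submodule.Quotient.mk_eq_zero]
    constructor
    · intro hx
      obtain ⟨y, -, hy⟩ := Submodule.mem_smul_pointwise_iff_exists _ _ _ |>.1 hx
      exact ⟨Submodule.Quotient.mk y, congrArg Submodule.Quotient.mk hy⟩
    · rintro ⟨y, hy⟩
      induction y using Submodule.Quotient.induction_on with | _ y
      rw [Submodule.mapQ_apply, Submodule.Quotient.eq] at hy
      obtain ⟨z, -, hz⟩ := Submodule.mem_smul_pointwise_iff_exists _ _ _ |>.1 hy
      refine Submodule.mem_smul_pointwise_iff_exists _ _ _ |>.2 ⟨y - b • z, trivial, ?_⟩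
      simp only [LinearMap.lsmul_apply] at hz
      rw [smul_sub, smul_smul, hz]
      simp
  · intro x
    induction x using Submodule.Quotient.induction_on with | _ x
    exact ⟨Submodule.Quotient.mk x, rfl⟩

/-- A sequence of products `a i * b i` followed by `rs` is weakly regular as soon as every sequence
obtained by choosing one factor of each product is. -/
theorem isWeaklyRegular_ofFn_mul_append {R : Type*} [CommRing R] {n : ℕ} {M : Type*}
    [AddCommGroup M] [Module R M] (a b : Fin n → R) (rs : List R)
    (h : ∀ p : Fin n → R, (∀ i, p i = a i ∨ p i = b i) →
      IsWeaklyRegular M (List.ofFn p ++ rs)) :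
    IsWeaklyRegular M (List.ofFn (fun i => a i * b i) ++ rs) := by
  induction n generalizing M with
  | zero => simpa using h a (fun i => i.elim0)
  | succ n ih =>
    have key (c : R) (hc : c = a 0 ∨ c = b 0) :
        IsWeaklyRegular M (c :: (List.ofFn (fun i : Fin n => a i.succ * b i.succ) ++ rs)) := by
      have hp (p : Fin n → R) (hp : ∀ i, p i = a i.succ ∨ p i = b i.succ) :
          IsWeaklyRegular M (c :: (List.ofFn p ++ rs)) := by
        simpa [List.ofFn_succ] using
          h (Fin.cons c p) (Fin.cases (by simpa using hc) (by simpa using hp))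
      refine (isWeaklyRegular_cons_iff M _ _).2 ⟨?_, ih _ _ fun p h' => ?_⟩
      · exact ((isWeaklyRegular_cons_iff M _ _).1 (hp (fun i => a i.succ) fun i => .inl rfl)).1
      · exact ((isWeaklyRegular_cons_iff M _ _).1 (hp p h')).2
    rw [List.ofFn_succ]
    exact isWeaklyRegular_mul_cons (key _ (.inl rfl)) (key _ (.inr rfl))

/-- Weak regularity of a sequence is preserved by ring isomorphisms. -/
theorem isWeaklyRegular_map_ringEquiv {R S : Type*} [CommRing R] [CommRing S] (e : R ≃+* S)
    {rs : List R} (h : IsWeaklyRegular R rs) : IsWeaklyRegular S (rs.map e) :=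
  (AddEquiv.isWeaklyRegular_congr (e := e.toAddEquiv) (List.forall₂_map_right_iff.mpr <|
    List.forall₂_same.mpr fun r _ x => map_mul e r x)).1 h

namespace MvPolynomial

/-- The variables, followed by a constant `t` regular in the coefficient ring, form a weakly regular
sequence. -/
theorem isWeaklyRegular_ofFn_X_append_C {S : Type*} [CommRing S] (n : ℕ) {t : S}
    (ht : t ∈ nonZeroDivisors S) :
    IsWeaklyRegular (MvPolynomial (Fin n) S)
      (List.ofFn (fun i : Fin n => (X i : MvPolynomial (Fin n) S)) ++ [C t]) := by
  have hspan (k : ℕ) :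
      Ideal.ofList ((List.ofFn fun i : Fin n => (X i : MvPolynomial (Fin n) S)).take k) =
        Ideal.span (Set.image X {i : Fin n | i.1 < k}) := by
    rw [Ideal.ofList]
    congr 1
    ext q
    simp only [Set.mem_ofPred_eq, Set.mem_image, List.mem_take_iff_getElem, List.getElem_ofFn,
      List.length_ofFn]
    constructor
    · rintro ⟨j, hj, rfl⟩
      exact ⟨⟨j, by omega⟩, by simp; omega, rfl⟩
    · rintro ⟨j, hj, rfl⟩
      exact ⟨j, by omega, rfl⟩
  rw [isWeaklyRegular_append_iff, isWeaklyRegular_singleton_iff]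
  constructor
  · refine ⟨fun k hk => ?_⟩
    rw [hspan, isSMulRegular_quotient_iff_mem_of_smul_mem]
    intro p hp
    simp only [smul_eq_mul, Ideal.mul_top, List.getElem_ofFn, mem_ideal_span_X_image] at hp ⊢
    intro m hm
    obtain ⟨i, hi, h⟩ := hp (Finsupp.single ⟨k, by simpa using hk⟩ 1 + m) (by
      rw [mem_support_iff, coeff_X_mul]; exact mem_support_iff.1 hm)
    refine ⟨i, hi, ?_⟩
    have : (⟨k, by simpa using hk⟩ : Fin n) ≠ i := by
      rintro rfl
      simp at hi
    simpa [Finsupp.single_apply, this] using h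
  · have := hspan n
    rw [List.take_of_length_le (by simp)] at this
    rw [this, isSMulRegular_quotient_iff_mem_of_smul_mem]
    intro p hp
    simp only [smul_eq_mul, Ideal.mul_top, mem_ideal_span_X_image] at hp ⊢
    intro m hm
    refine hp m ?_
    rw [mem_support_iff] at hm ⊢
    rw [coeff_C_mul]
    exact fun h => hm ((mem_nonZeroDivisors_iff.1 ht).1 _ h)

/-- The algebra endomorphism substituting `∑ j, B i j * X j + C (τ i)` for `X i`. -/
noncomputable def affineSubst {S σ : Type*} [CommRing S] [Fintype σ]
    (B : Matrix σ σ S) (τ : σ → S) :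
    MvPolynomial σ S →ₐ[S] MvPolynomial σ S :=
  aeval fun i => ∑ j, C (B i j) * X j + C (τ i)

theorem affineSubst_comp {S σ : Type*} [CommRing S] [Fintype σ] (B B' : Matrix σ σ S)
    (τ τ' : σ → S) :
    (affineSubst B τ).comp (affineSubst B' τ') = affineSubst (B' * B) (B'.mulVec τ + τ') := by
  ext i : 1
  simp only [affineSubst, AlgHom.comp_apply, aeval_X, map_add, map_sum, map_mul, algHom_C,
    algebraMap_eq, Matrix.mul_apply, Matrix.mulVec, dotProduct, Pi.add_apply, mul_add,
    Finset.sum_add_distrib, Finset.mul_sum, Finset.sum_mul, add_assoc, mul_assoc]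
  rw [Finset.sum_comm]

theorem affineSubst_one_zero {S σ : Type*} [CommRing S] [Fintype σ] [DecidableEq σ] :
    affineSubst (1 : Matrix σ σ S) 0 = AlgHom.id S _ := by
  ext i : 1
  simp [affineSubst, Matrix.one_apply]

/-- Affine forms with invertible linear part, followed by a constant `t` regular in the coefficient
ring, form a weakly regular sequence. -/
theorem isWeaklyRegular_ofFn_affine_append_C {S : Type*} [CommRing S] {n : ℕ}
    {t : S} (ht : t ∈ nonZeroDivisors S) {B : Matrix (Fin n) (Fin n) S} (hB : IsUnit B)
    (τ : Fin n → S) :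
    IsWeaklyRegular (MvPolynomial (Fin n) S)
      (List.ofFn (fun i => ∑ j, C (B i j) * X j + C (τ i)) ++ [C t]) := by
  obtain ⟨U, rfl⟩ := hB
  let e : MvPolynomial (Fin n) S ≃ₐ[S] MvPolynomial (Fin n) S :=
    AlgEquiv.ofAlgHom (affineSubst U τ) (affineSubst (U⁻¹).val (-(U⁻¹).val.mulVec τ))
      (by rw [affineSubst_comp]; simp [affineSubst_one_zero])
      (by rw [affineSubst_comp]; simp [affineSubst_one_zero, Matrix.mulVec_neg])
  have he (i : Fin n) : e.toRingEquiv (X i) = ∑ j, C (U.val i j) * X j + C (τ i) := aeval_X _ i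
  have hC : e.toRingEquiv (C t) = C t := e.commutes t
  have h := isWeaklyRegular_map_ringEquiv e.toRingEquiv (isWeaklyRegular_ofFn_X_append_C n ht)
  rw [List.map_append, List.map_ofFn, List.map_singleton] at h
  simpa only [Function.comp_def, he, hC] using h

theorem sum_C_mul_sub_two_C_mul {S σ : Type*} [CommRing S] [Fintype σ] (a : σ → S) (t : S)
    (x : MvPolynomial σ S) :
    ∑ j, C (a j) * x * X j - 2 * C t * x = x * (∑ j, C (a j) * X j + C (-2 * t)) := by
  have h : ∑ j, C (a j) * x * X j = x * ∑ j, C (a j) * X j := by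
    rw [Finset.mul_sum]
    exact Finset.sum_congr rfl fun j _ => by ring
  rw [h, map_mul, map_neg, map_ofNat]
  ring

end MvPolynomial

end

/-- If the quadratic form of a real matrix is positive definite, then replacing some of its rows by
rows of the identity matrix yields an invertible matrix. -/
theorem Matrix.isUnit_ite_single_of_pos {ι : Type*} [Fintype ι] [DecidableEq ι] {A : Matrix ι ι ℝ}
    (hA : ∀ v : ι → ℝ, v ≠ 0 → 0 < ∑ i, ∑ j, A i j * v i * v j) (s : ι → Bool) :
    IsUnit (Matrix.of fun i => if s i then Pi.single i 1 else A i) := by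
  rw [← Matrix.mulVec_injective_iff_isUnit]
  refine (injective_iff_map_eq_zero (Matrix.mulVecLin _)).2 fun v hv => ?_
  by_contra hne
  refine (hA v hne).ne' (Finset.sum_eq_zero fun i _ => ?_)
  have hi := congrFun hv i
  cases h : s i
  · have : ∑ j, A i j * v j = 0 := by simpa [Matrix.mulVec, dotProduct, h] using hi
    calc ∑ j, A i j * v i * v j = v i * ∑ j, A i j * v j := by
          rw [Finset.mul_sum]; exact Finset.sum_congr rfl fun j _ => by ring
      _ = 0 := by rw [this, mul_zero]
  · have : v i = 0 := by simpa [Matrix.mulVec, dotProduct, h, Pi.single_apply] using hi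
    simp [this]

/-- If `A` is an `n × n` real matrix whose associated quadratic form is positive definite,
then in `ℂ[x_1, …, x_n, t]` (realized as the polynomial ring over `ℂ[t] = Polynomial ℂ`
in the variables `x_1, …, x_n`), the sequence
`g_1, …, g_n, t` with `g i = ∑ j, A i j * x i * x j − 2 t x i` is a regular sequence. -/
theorem deformed_quadrics_and_t_isRegular_sequence
    (n : ℕ) (hn : 1 ≤ n) (A : Matrix (Fin n) (Fin n) ℝ)
    (hA : ∀ v : Fin n → ℝ, v ≠ 0 → 0 < ∑ i, ∑ j, A i j * v i * v j) :
    RingTheory.Sequence.IsRegular (MvPolynomial (Fin n) (Polynomial ℂ))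
      (List.ofFn (fun i : Fin n =>
          (∑ j, C (Polynomial.C (A i j : ℂ)) * X i * X j)
            - 2 * C Polynomial.X * X i) ++
        [(C Polynomial.X : MvPolynomial (Fin n) (Polynomial ℂ))]) := by
  have hweak := isWeaklyRegular_ofFn_mul_append (M := MvPolynomial (Fin n) (Polynomial ℂ))
    (fun i : Fin n => X i)
    (fun i => ∑ j, C (Polynomial.C (A i j : ℂ)) * X j + C (-2 * Polynomial.X))
    [(C Polynomial.X : MvPolynomial (Fin n) (Polynomial ℂ))] ?_
  · have hmul : (fun i : Fin n => (∑ j, C (Polynomial.C (A i j : ℂ)) * X i * X j)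
            - 2 * C Polynomial.X * X i : Fin n → MvPolynomial (Fin n) (Polynomial ℂ)) =
        fun i => X i * (∑ j, C (Polynomial.C (A i j : ℂ)) * X j + C (-2 * Polynomial.X)) :=
      funext fun i => MvPolynomial.sum_C_mul_sub_two_C_mul _ _ _
    rw [← hmul] at hweak
    refine ⟨hweak, fun htop => ?_⟩
    let φ : MvPolynomial (Fin n) (Polynomial ℂ) →+* ℂ :=
      eval₂Hom (Polynomial.evalRingHom 0) fun _ => 0
    rw [smul_eq_mul, Ideal.mul_top] at htop
    have hle : (⊤ : Ideal (MvPolynomial (Fin n) (Polynomial ℂ))) ≤ RingHom.ker φ := by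
      rw [htop, Ideal.ofList, Ideal.span_le]
      intro q hq
      simp only [Set.mem_ofPred_eq, List.mem_append, List.mem_ofFn, List.mem_singleton] at hq
      rw [SetLike.mem_coe, RingHom.mem_ker]
      rcases hq with ⟨i, rfl⟩ | rfl <;> simp [φ]
    exact RingHom.ker_ne_top φ (top_le_iff.1 hle)
  · intro p hp
    classical
    choose s hs using fun i => (show ∃ s : Bool, p i = if s then X i else
        ∑ j, C (Polynomial.C (A i j : ℂ)) * X j + C (-2 * Polynomial.X) from
      (hp i).elim (fun h => ⟨true, by simpa using h⟩) fun h => ⟨false, by simpa using h⟩)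
    let B : Matrix (Fin n) (Fin n) ℝ := .of fun i => if s i then Pi.single i 1 else A i
    let ψ : ℝ →+* Polynomial ℂ := Polynomial.C.comp Complex.ofRealHom
    have hB : IsUnit (ψ.mapMatrix B) := (Matrix.isUnit_ite_single_of_pos hA s).map _
    convert MvPolynomial.isWeaklyRegular_ofFn_affine_append_C
      (mem_nonZeroDivisors_of_ne_zero Polynomial.X_ne_zero) hB (fun i => if s i then 0 else -2 * Polynomial.X) using 3
    funext i
    rw [hs]
    cases h : s i
    · simp [B, ψ, h]
    · simp [B, ψ, h, Pi.single_apply, apply_ite]
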